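/- arXiv:1909.11465 — 11 statements merged into one kernel-verified Lean document; each statement's English description precedes it below -/
import Mathlib

section
/- Let n ≥ 1 and let g, h : 𝔽₂ⁿ → 𝔽₂ be Boolean functions with deg(g) ≤ 2 and deg(h) ≤ 2. Define f : 𝔽₂^(n+1) → 𝔽₂ by f(x, y) = y·g(x) + (1+y)·h(x), and assume deg(f) = 3. Then f is balanced if and only if either both g and h are balanced, or g and h are both unbalanced of degree exactly 2 and there exists an affinity φ of 𝔽₂ⁿ with g = h∘φ + 1. -/
/-- The Hamming weight of a Boolean function: the number of inputs mapped to 1. -/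
def wt {α : Type*} [Fintype α] (f : α → ZMod 2) : ℕ :=
  (Finset.univ.filter fun x => f x = 1).card

/-- The derivative of a Boolean function at `a`. -/
def Dop {α : Type*} [Add α] (a : α) (f : α → ZMod 2) : α → ZMod 2 :=
  fun x => f (x + a) + f x

/-- `degLE d f` means the algebraic degree of `f` is at most `d`:
all `(d+1)`-fold iterated derivatives vanish. -/
def degLE {α : Type*} [Add α] (d : ℕ) (f : α → ZMod 2) : Prop :=
  ∀ l : List α, l.length = d + 1 → l.foldr Dop f = fun _ => 0

section BooleanFunctions

variable {V : Type*}

theorem degLE.apply_three [Add V] {q : V → ZMod 2} (hq : degLE 2 q) (a b c x : V) :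
    Dop c (Dop b (Dop a q)) x = 0 :=
  congrFun (hq [c, b, a] rfl) x

theorem degLE_two_iff [Add V] {q : V → ZMod 2} :
    degLE 2 q ↔ ∀ a b c x : V, Dop c (Dop b (Dop a q)) x = 0 := by
  refine ⟨degLE.apply_three, fun H l hl => ?_⟩
  obtain ⟨c, b, a, rfl⟩ := List.length_eq_three.mp hl
  exact funext (H a b c)

theorem ZMod.two_eq_zero_or_one (c : ZMod 2) : c = 0 ∨ c = 1 := by
  revert c; decide

theorem ZMod.two_eq_of_add_eq_zero {c d : ZMod 2} (h : c + d = 0) : c = d := by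
  revert c d; decide

theorem wt_eq_zero_iff [Fintype V] {q : V → ZMod 2} : wt q = 0 ↔ ∀ x, q x = 0 := by
  rw [wt, Finset.card_eq_zero, Finset.filter_eq_empty_iff]
  refine ⟨fun H x => (ZMod.two_eq_zero_or_one _).resolve_right (H (Finset.mem_univ x)),
    fun H x _ => by simp [H x]⟩

theorem wt_eq_card_iff [Fintype V] {q : V → ZMod 2} :
    wt q = Fintype.card V ↔ ∀ x, q x = 1 := by
  rw [wt, ← Finset.card_univ, Finset.card_filter_eq_iff]
  simp

theorem wt_eq_sum [Fintype V] (q : V → ZMod 2) : wt q = ∑ x, (q x).val := by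
  rw [wt, Finset.card_filter]
  refine Finset.sum_congr rfl fun x _ => ?_
  generalize q x = c
  revert c; decide

theorem wt_comp_equiv {W : Type*} [Fintype V] [Fintype W] (q : V → ZMod 2) (e : W ≃ V) :
    wt (fun x => q (e x)) = wt q := by
  rw [wt_eq_sum, wt_eq_sum]
  exact Equiv.sum_comp e fun x => (q x).val

theorem wt_add_one [Fintype V] (q : V → ZMod 2) :
    wt (fun x => q x + 1) + wt q = Fintype.card V := by
  rw [wt_eq_sum, wt_eq_sum, ← Finset.sum_add_distrib, Fintype.card_eq_sum_ones]
  refine Finset.sum_congr rfl fun x _ => ?_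
  generalize q x = c
  revert c; decide

theorem wt_prod_zmod_two [Fintype V] (f : V × ZMod 2 → ZMod 2) :
    wt f = wt (fun x => f (x, 1)) + wt fun x => f (x, 0) := by
  rw [wt_eq_sum, wt_eq_sum, wt_eq_sum, Fintype.sum_prod_type, ← Finset.sum_add_distrib]
  refine Finset.sum_congr rfl fun x _ => ?_
  rw [add_comm]
  exact Fin.sum_univ_two fun y : ZMod 2 => (f (x, y)).val

theorem wt_add_mul [Fintype V] (q : V → ZMod 2) :
    wt (fun p : V × ZMod 2 × ZMod 2 => q p.1 + p.2.1 * p.2.2) = 2 * wt q + Fintype.card V := by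
  rw [wt_eq_sum, wt_eq_sum, Fintype.sum_prod_type, Fintype.card_eq_sum_ones, Finset.mul_sum,
    ← Finset.sum_add_distrib]
  refine Finset.sum_congr rfl fun x _ => ?_
  dsimp only
  generalize q x = c
  revert c; decide

/-- A Boolean function with a derivative identically one is balanced. -/
theorem two_mul_wt_of_dop_eq_one [Fintype V] [AddGroup V] {q : V → ZMod 2} {a : V}
    (H : ∀ x, Dop a q x = 1) : 2 * wt q = Fintype.card V := by
  have h1 : wt (fun x => q (x + a)) = wt q := wt_comp_equiv q (Equiv.addRight a)
  have h2 : (fun x => q (x + a)) = fun x => q x + 1 := funext fun x => by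
    have := H x
    unfold Dop at this
    rw [← this, add_comm (q (x + a)), ← add_assoc, CharTwo.add_self_eq_zero, zero_add]
  have h3 := wt_add_one q
  rw [← h2] at h3
  omega

/-- An unbalanced Boolean function of degree at most one is constant. -/
theorem eq_const_of_dop_dop_eq_zero [Fintype V] [AddGroup V] {q : V → ZMod 2}
    (hu : 2 * wt q ≠ Fintype.card V) (H : ∀ a b x : V, Dop b (Dop a q) x = 0) (x : V) :
    q x = q 0 := by
  by_contra hx
  refine hu (two_mul_wt_of_dop_eq_one (a := x) fun y => ?_)
  have h1 := H x y 0
  have h2 : Dop x q 0 = 1 := by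
    simp only [Dop, zero_add]
    revert hx
    generalize q x = c
    generalize q 0 = d
    revert c d; decide
  rw [Dop, zero_add, h2] at h1
  exact ZMod.two_eq_of_add_eq_zero h1

variable [AddCommGroup V] [Module (ZMod 2) V]

theorem degLE.comp_add {W : Type*} [AddCommGroup W] [Module (ZMod 2) W] {q : V → ZMod 2}
    (hq : degLE 2 q) (i : W →ₗ[ZMod 2] V) (z : V) : degLE 2 fun u => q (i u + z) := by
  rw [degLE_two_iff] at hq ⊢
  intro a b c x
  have := hq (i a) (i b) (i c) (i x + z)
  simp only [Dop, map_add] at this ⊢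
  simpa only [add_right_comm _ z] using this

/-- The polar form of a function of degree at most two, with one argument fixed. -/
def polarForm (q : V → ZMod 2) (hq : degLE 2 q) (a : V) : V →ₗ[ZMod 2] ZMod 2 :=
  AddMonoidHom.toZModLinearMap 2
    { toFun := fun x => Dop a q x + Dop a q 0
      map_zero' := CharTwo.add_self_eq_zero _
      map_add' := fun x y => by
        have := hq.apply_three a y x 0
        simp only [Dop, zero_add] at this ⊢
        grind }

theorem polarForm_apply (q : V → ZMod 2) (hq : degLE 2 q) (a x : V) :
    polarForm q hq a x = Dop a q x + Dop a q 0 := rfl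

theorem dop_add_eq (q : V → ZMod 2) (hq : degLE 2 q) (a x y : V) :
    Dop a q (x + y) = Dop a q x + polarForm q hq a y := by
  have := (polarForm q hq a).map_add x y
  simp only [polarForm_apply] at this ⊢
  grind

theorem polarForm_self (q : V → ZMod 2) (hq : degLE 2 q) (a : V) : polarForm q hq a a = 0 := by
  simp only [polarForm_apply, Dop, zero_add, ZModModule.add_self]
  grind

theorem polarForm_comm (q : V → ZMod 2) (hq : degLE 2 q) (a b : V) :
    polarForm q hq a b = polarForm q hq b a := by
  simp only [polarForm_apply, Dop, zero_add, add_comm b a]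
  grind

/-- Splitting off the plane spanned by `a` and `b` along a pair of linear forms dual to them. -/
def splitPlane (α β : V →ₗ[ZMod 2] ZMod 2) (a b : V) (haa : α a = 0) (hab : α b = 1)
    (hba : β a = 1) (hbb : β b = 0) :
    ((LinearMap.ker α ⊓ LinearMap.ker β : Submodule (ZMod 2) V) × ZMod 2 × ZMod 2)
      ≃ₗ[ZMod 2] V where
  toFun p := p.1 + p.2.1 • a + p.2.2 • b
  map_add' p r := by
    simp only [Prod.fst_add, Prod.snd_add, Submodule.coe_add, add_smul]
    abel
  map_smul' c p := by
    simp only [Prod.smul_fst, Prod.smul_snd, Submodule.coe_smul, smul_add, smul_assoc,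
      RingHom.id_apply]
  invFun x := (⟨x - β x • a - α x • b, by simp [haa, hab, hba, hbb]⟩, β x, α x)
  left_inv := by
    rintro ⟨⟨u, hu⟩, s, t⟩
    obtain ⟨h1, h2⟩ := hu
    rw [SetLike.mem_coe, LinearMap.mem_ker] at h1 h2
    ext
    · simp only [map_add, map_smul, h1, h2, haa, hab, hba, hbb, smul_eq_mul, mul_one, mul_zero,
        zero_add, add_zero]
      abel
    · simp [h2, hba, hbb]
    · simp [h1, haa, hab]
  right_inv x := by
    simp only
    abel

theorem splitPlane_apply (α β : V →ₗ[ZMod 2] ZMod 2) (a b : V) (haa : α a = 0) (hab : α b = 1)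
    (hba : β a = 1) (hbb : β b = 0) (u : (LinearMap.ker α ⊓ LinearMap.ker β : Submodule _ V))
    (s t : ZMod 2) :
    splitPlane α β a b haa hab hba hbb (u, s, t) = u + s • a + t • b := rfl

/-- A function of degree exactly two splits off a hyperbolic plane, up to a translation. -/
theorem exists_hyperbolic_splitting {q : V → ZMod 2} (hq : degLE 2 q)
    (hne : ∃ a b x : V, Dop b (Dop a q) x ≠ 0) :
    ∃ (U : Submodule (ZMod 2) V) (e : (U × ZMod 2 × ZMod 2) ≃ₗ[ZMod 2] V) (z : V),
      ∀ u s t, q (e (u, s, t) + z) = q (u + z) + s * t := by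
  obtain ⟨a, b, x, hx⟩ := hne
  have hab : polarForm q hq a b = 1 := by
    refine (ZMod.two_eq_zero_or_one _).resolve_left fun h0 => hx ?_
    rw [Dop, dop_add_eq q hq, h0, add_zero, CharTwo.add_self_eq_zero]
  have hba : polarForm q hq b a = 1 := by rw [polarForm_comm, hab]
  have haa := polarForm_self q hq a
  have hbb := polarForm_self q hq b
  obtain ⟨z, hza, hzb⟩ : ∃ z, Dop a q z = 0 ∧ Dop b q z = 0 := by
    refine ⟨Dop a q 0 • b + Dop b q 0 • a, ?_, ?_⟩
    · rw [← zero_add (_ + _), dop_add_eq q hq]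
      simp [haa, hab, CharTwo.add_self_eq_zero]
    · rw [← zero_add (_ + _), dop_add_eq q hq]
      simp [hbb, hba, CharTwo.add_self_eq_zero]
  refine ⟨_, splitPlane _ _ a b haa hab hba hbb, z, fun u s t => ?_⟩
  rw [splitPlane_apply]
  obtain ⟨u, h1, h2⟩ := u
  rw [SetLike.mem_coe, LinearMap.mem_ker] at h1 h2
  have ha : Dop a q (z + u) = 0 := by rw [dop_add_eq q hq, h1, hza, add_zero]
  have hb : Dop b q (z + u) = 0 := by rw [dop_add_eq q hq, h2, hzb, add_zero]
  have hab' : Dop a q (z + u + b) = 1 := by rw [dop_add_eq q hq, ha, hab, zero_add]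
  simp only [Dop] at ha hb hab'
  rw [add_comm z u] at ha hb hab'
  have e1 : u + a + z = u + z + a := by abel
  have e2 : u + b + z = u + z + b := by abel
  have e3 : u + a + b + z = u + z + b + a := by abel
  rcases ZMod.two_eq_zero_or_one s with rfl | rfl <;>
    rcases ZMod.two_eq_zero_or_one t with rfl | rfl <;>
    simp only [zero_smul, one_smul, add_zero, mul_zero, mul_one, e1, e2, e3] <;>
    grind

theorem wt_eq_of_splitting [Fintype V] {q : V → ZMod 2} {U : Submodule (ZMod 2) V} [Fintype U]
    (e : (U × ZMod 2 × ZMod 2) ≃ₗ[ZMod 2] V) (z : V)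
    (H : ∀ u s t, q (e (u, s, t) + z) = q (u + z) + s * t) :
    wt q = 2 * wt (fun u : U => q (u + z)) + Fintype.card U := by
  rw [← wt_add_mul, ← wt_comp_equiv q (e.toEquiv.trans (Equiv.addRight z))]
  exact congrArg wt (funext fun p => H p.1 p.2.1 p.2.2)

end BooleanFunctions

/-- Unbalanced Boolean functions of degree at most two with equal weights are affinely
equivalent. -/
theorem exists_affine_equiv_of_wt_eq (n : ℕ) :
    ∀ {V W : Type} [AddCommGroup V] [Module (ZMod 2) V] [Fintype V]
      [AddCommGroup W] [Module (ZMod 2) W] [Fintype W] (p : V → ZMod 2) (q : W → ZMod 2),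
      Module.finrank (ZMod 2) V = n → Module.finrank (ZMod 2) W = n →
      degLE 2 p → degLE 2 q → wt p = wt q → 2 * wt p ≠ Fintype.card V →
      ∃ (M : V ≃ₗ[ZMod 2] W) (w : W), ∀ x, p x = q (M x + w) := by
  induction n using Nat.strong_induction_on with
  | _ n ih =>
    intro V W _ _ _ _ _ _ p q hV hW hp hq hwt hu
    have hcard : Fintype.card V = Fintype.card W := by
      rw [Module.card_eq_pow_finrank (K := ZMod 2), Module.card_eq_pow_finrank (K := ZMod 2) (V := W),
        hV, hW]
    have hequiv := LinearEquiv.ofFinrankEq (R := ZMod 2) V W (hV.trans hW.symm)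
    by_cases h0 : wt p = 0
    · exact ⟨hequiv, 0, fun x => by
        rw [wt_eq_zero_iff.mp h0 x, wt_eq_zero_iff.mp (hwt.symm.trans h0)]⟩
    by_cases h1 : wt p = Fintype.card V
    · exact ⟨hequiv, 0, fun x => by
        rw [wt_eq_card_iff.mp h1 x, wt_eq_card_iff.mp (hwt.symm.trans (h1.trans hcard))]⟩
    have key : ∀ {X : Type} [AddCommGroup X] [Fintype X] (r : X → ZMod 2),
        2 * wt r ≠ Fintype.card X → wt r ≠ 0 → wt r ≠ Fintype.card X →
        ∃ a b x : X, Dop b (Dop a r) x ≠ 0 := by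
      intro X _ _ r hr hr0 hr1
      by_contra! H
      have hc := eq_const_of_dop_dop_eq_zero hr H
      rcases ZMod.two_eq_zero_or_one (r 0) with h | h
      · exact hr0 (wt_eq_zero_iff.mpr fun x => (hc x).trans h)
      · exact hr1 (wt_eq_card_iff.mpr fun x => (hc x).trans h)
    obtain ⟨U, e, z, he⟩ := exists_hyperbolic_splitting hp (key p hu h0 h1)
    obtain ⟨U', e', z', he'⟩ := exists_hyperbolic_splitting hq
      (key q (by omega) (by omega) (by omega))
    have := Fintype.ofFinite U
    have := Fintype.ofFinite U'
    have hU := e.finrank_eq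
    have hU' := e'.finrank_eq
    simp only [Module.finrank_prod, Module.finrank_self] at hU hU'
    have hc := Fintype.card_congr e.toEquiv
    have hc' := Fintype.card_congr e'.toEquiv
    simp only [Fintype.card_prod, ZMod.card] at hc hc'
    have hw := wt_eq_of_splitting e z he
    have hw' := wt_eq_of_splitting e' z' he'
    obtain ⟨M, w, hM⟩ := ih (Module.finrank (ZMod 2) U) (by omega)
      (fun u : U => p (u + z)) (fun u : U' => q (u + z')) rfl (by omega)
      (hp.comp_add U.subtype z) (hq.comp_add U'.subtype z') (by omega) (by omega)
    let N : V ≃ₗ[ZMod 2] W :=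
      e.symm ≪≫ₗ (M.prodCongr (LinearEquiv.refl (ZMod 2) (ZMod 2 × ZMod 2))) ≪≫ₗ e'
    refine ⟨N, N z + e' (w, 0, 0) + z', fun x => ?_⟩
    obtain ⟨⟨u, s, t⟩, hust⟩ := e.surjective (x + z)
    have hx : e (u, s, t) + z = x := by rw [hust, add_assoc, ZModModule.add_self, add_zero]
    have hN : N x + (N z + e' (w, 0, 0) + z') = e' (M u + w, s, t) + z' := by
      rw [← add_assoc, ← add_assoc, ← map_add, ← hust]
      simp [N, ← map_add]
    rw [hN, he', ← hM u, ← he, hx]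

theorem stmt_2 (n : ℕ) (hn : 1 ≤ n)
    (g h : (Fin n → ZMod 2) → ZMod 2)
    (hg2 : degLE 2 g) (hh2 : degLE 2 h)
    (f : ((Fin n → ZMod 2) × ZMod 2) → ZMod 2)
    (hf : ∀ (x : Fin n → ZMod 2) (y : ZMod 2), f (x, y) = y * g x + (1 + y) * h x)
    (hf3 : degLE 3 f ∧ ¬ degLE 2 f) :
    wt f = 2 ^ n ↔
      ((wt g = 2 ^ (n - 1) ∧ wt h = 2 ^ (n - 1)) ∨
       (wt g ≠ 2 ^ (n - 1) ∧ wt h ≠ 2 ^ (n - 1) ∧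
        ¬ degLE 1 g ∧ ¬ degLE 1 h ∧
        ∃ (M : (Fin n → ZMod 2) ≃ₗ[ZMod 2] (Fin n → ZMod 2)) (w : Fin n → ZMod 2),
          ∀ x, g x = h (M x + w) + 1)) := by
  have hwf : wt f = wt g + wt h := by
    have h2 : (1 + 1 : ZMod 2) = 0 := by decide
    rw [wt_prod_zmod_two]
    simp [hf, h2]
  have hpow : 2 ^ n = 2 * 2 ^ (n - 1) := by
    rw [← pow_succ', Nat.sub_add_cancel hn]
  have hcard : Fintype.card (Fin n → ZMod 2) = 2 ^ n := by simp
  have hadd := wt_add_one h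
  rw [hcard] at hadd
  constructor
  · intro hb
    by_cases hg : wt g = 2 ^ (n - 1)
    · exact Or.inl ⟨hg, by omega⟩
    have hnonconst : ∀ c : ZMod 2, (∀ x, g x = c) → (∀ x, h x = c + 1) → False := by
      intro c hgc hhc
      refine hf3.2 (degLE_two_iff.mpr fun a b d x => ?_)
      have hfc : f = fun p => p.2 + c + 1 := funext fun ⟨x, y⟩ => by
        rw [hf, hgc, hhc]
        ring_nf
        grind
      simp only [hfc, Dop, Prod.snd_add]
      grind
    have hne : wt g ≠ 0 ∧ wt g ≠ 2 ^ n := by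
      constructor
      · intro h0
        refine hnonconst 0 (wt_eq_zero_iff.mp h0) fun x => ?_
        rw [wt_eq_card_iff.mp (show wt h = _ by omega) x, zero_add]
      · intro h1
        refine hnonconst 1 (wt_eq_card_iff.mp (by omega)) fun x => ?_
        rw [wt_eq_zero_iff.mp (show wt h = 0 by omega) x]
        decide
    have hdeg : ∀ q : (Fin n → ZMod 2) → ZMod 2, wt q ≠ 2 ^ (n - 1) → wt q ≠ 0 →
        wt q ≠ 2 ^ n → ¬ degLE 1 q := by
      intro q hq hq0 hq1 hd
      have hc := eq_const_of_dop_dop_eq_zero (q := q) (by omega)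
        fun a b x => congrFun (hd [b, a] rfl) x
      rcases ZMod.two_eq_zero_or_one (q 0) with h | h
      · exact hq0 (wt_eq_zero_iff.mpr fun x => (hc x).trans h)
      · exact hq1 ((wt_eq_card_iff.mpr fun x => (hc x).trans h).trans hcard)
    have hdh : degLE 2 fun x => h x + 1 := by
      rw [degLE_two_iff] at hh2 ⊢
      intro a b c x
      rw [← hh2 a b c x]
      simp only [Dop]
      grind
    exact Or.inr ⟨hg, by omega, hdeg g hg hne.1 hne.2, hdeg h (by omega) (by omega) (by omega),
      exists_affine_equiv_of_wt_eq n g (fun x => h x + 1) (by simp) (by simp) hg2 hdh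
        (by omega) (by omega)⟩
  · rintro (⟨hg, hh⟩ | ⟨-, -, -, -, M, w, hM⟩)
    · omega
    · have : wt g = wt fun x => h x + 1 := by
        rw [← wt_comp_equiv (fun x => h x + 1) (M.toEquiv.trans (Equiv.addRight w))]
        exact congrArg wt (funext hM)
      omega
end

section
/- Let n be even, n ≥ 2, and let g, h : 𝔽₂ⁿ → 𝔽₂ both be bent. Define f : 𝔽₂^(n+1) → 𝔽₂ by f(x, y) = y·g(x) + (1+y)·h(x). Then f is balanced if and only if w(g) ≠ w(h). -/
/-- A Boolean function on `n` variables is bent if all its nontrivial derivatives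
are balanced. -/
def IsBent {n : ℕ} (f : (Fin n → ZMod 2) → ZMod 2) : Prop :=
  ∀ a : Fin n → ZMod 2, a ≠ 0 → wt (Dop a f) = 2 ^ (n - 1)

/-- The nontrivial additive character of `ZMod 2`, with integer values. -/
def sgnChar (z : ZMod 2) : ℤ := if z = 1 then -1 else 1

theorem sgnChar_add (a b : ZMod 2) : sgnChar (a + b) = sgnChar a * sgnChar b := by
  revert a b
  decide

theorem sum_sgnChar {α : Type*} [Fintype α] (f : α → ZMod 2) :
    ∑ x, sgnChar (f x) = Fintype.card α - 2 * wt f := by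
  have h : ∀ z : ZMod 2, sgnChar z = 1 - 2 * (if z = 1 then 1 else 0) := by decide
  simp only [h, wt, Finset.sum_sub_distrib, ← Finset.mul_sum, Finset.sum_boole]
  simp

theorem sum_sgnChar_sq {α : Type*} [Fintype α] [AddGroup α] (f : α → ZMod 2) :
    (∑ x, sgnChar (f x)) ^ 2 = ∑ a, ∑ x, sgnChar (Dop a f x) := by
  rw [Finset.sum_comm, sq, Finset.sum_mul_sum]
  refine Finset.sum_congr rfl fun x _ => ?_
  rw [← Equiv.sum_comp (Equiv.addLeft x)]
  refine Finset.sum_congr rfl fun a _ => ?_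
  simp [Dop, sgnChar_add, mul_comm]

theorem wt_Dop_zero {α : Type*} [Fintype α] [AddGroup α] (f : α → ZMod 2) :
    wt (Dop 0 f) = 0 := by
  simp [wt, Dop, CharTwo.add_self_eq_zero]

theorem IsBent.sq_eq {n : ℕ} (hn : n ≠ 0) {f : (Fin n → ZMod 2) → ZMod 2} (hf : IsBent f) :
    ((2 : ℤ) ^ n - 2 * wt f) ^ 2 = 2 ^ n := by
  have hcard : (Fintype.card (Fin n → ZMod 2) : ℤ) = 2 ^ n := by simp [ZMod.card]
  have h := sum_sgnChar_sq f
  simp only [sum_sgnChar, hcard] at h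
  rw [h, Finset.sum_eq_single 0]
  · simp [wt_Dop_zero]
  · intro a _ ha
    rw [hf a ha]
    push_cast
    rw [mul_pow_sub_one hn, sub_self]
  · simp

theorem wt_prod {α : Type*} [Fintype α] (g h : α → ZMod 2) (f : α × ZMod 2 → ZMod 2)
    (hf : ∀ x y, f (x, y) = y * g x + (1 + y) * h x) : wt f = wt g + wt h := by
  have h2 : (1 : ZMod 2) + 1 = 0 := by decide
  have hsum : ∀ F : ZMod 2 → ℕ, ∑ y, F y = F 0 + F 1 := fun F => Fin.sum_univ_two F
  simp only [wt, Finset.card_filter, Fintype.sum_prod_type, hsum, hf, h2, zero_mul, one_mul,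
    zero_add, add_zero, Finset.sum_add_distrib]
  rw [add_comm]

theorem stmt_3 (n : ℕ) (hne : Even n) (hn : 2 ≤ n)
    (g h : (Fin n → ZMod 2) → ZMod 2)
    (hg : IsBent g) (hh : IsBent h)
    (f : ((Fin n → ZMod 2) × ZMod 2) → ZMod 2)
    (hf : ∀ (x : Fin n → ZMod 2) (y : ZMod 2), f (x, y) = y * g x + (1 + y) * h x) :
    wt f = 2 ^ n ↔ wt g ≠ wt h := by
  have hg2 := hg.sq_eq (by omega)
  have hh2 := hh.sq_eq (by omega)
  have hpos : (0 : ℤ) < 2 ^ n := by positivity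
  rw [wt_prod g h f hf]
  zify
  constructor
  · intro hs he
    have h0 : (2 : ℤ) ^ n - 2 * wt g = 0 := by rw [← he] at hs; linarith
    rw [h0] at hg2
    linarith
  · intro hw
    rcases sq_eq_sq_iff_eq_or_eq_neg.mp (hg2.trans hh2.symm) with h1 | h1
    · exact absurd (by linarith) hw
    · linarith
end

section
/- Let n be even, n ≥ 2, let g : 𝔽₂ⁿ → 𝔽₂ be bent and h : 𝔽₂ⁿ → 𝔽₂ be arbitrary. Define f : 𝔽₂^(n+1) → 𝔽₂ by f(x, y) = y·g(x) + h(x). Then the linear space of f is trivial: V(f) = {0}. -/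
/-- A nontrivial derivative of a bent function does not vanish identically. -/
theorem IsBent.eq_zero_of_forall_add_eq_zero {n : ℕ} {g : (Fin n → ZMod 2) → ZMod 2}
    (hg : IsBent g) {a : Fin n → ZMod 2} (ha : ∀ x, g (x + a) + g x = 0) : a = 0 := by
  by_contra hne
  have hwt := hg a hne
  simp only [wt, Dop, ha, zero_ne_one, Finset.filter_false, Finset.card_empty] at hwt
  exact (Nat.two_pow_pos (n - 1)).ne hwt

theorem stmt_6 (n : ℕ) (hne : Even n) (hn : 2 ≤ n)
    (g : (Fin n → ZMod 2) → ZMod 2) (hg : IsBent g)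
    (h : (Fin n → ZMod 2) → ZMod 2)
    (f : ((Fin n → ZMod 2) × ZMod 2) → ZMod 2)
    (hf : ∀ (x : Fin n → ZMod 2) (y : ZMod 2), f (x, y) = y * g x + h x) :
    {a : (Fin n → ZMod 2) × ZMod 2 | ∃ c : ZMod 2, ∀ z, f (z + a) + f z = c} = {0} := by
  ext ⟨a, b⟩
  simp only [Set.mem_ofPred_eq, Set.mem_singleton_iff, Prod.forall, Prod.mk_add_mk, hf]
  constructor
  · rintro ⟨c, hc⟩
    have ha : a = 0 := hg.eq_zero_of_forall_add_eq_zero fun x => by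
      linear_combination hc x 1 - hc x 0
    subst ha
    have hb : b = 0 := by
      by_contra hb
      obtain rfl : b = 1 := Fin.eq_one_of_ne_zero b hb
      have hgc : ∀ x, g x = c := fun x => by
        have hx := hc x 0
        rw [add_zero] at hx
        linear_combination hx - CharTwo.add_self_eq_zero (h x)
      have hone : (fun _ => 1 : Fin n → ZMod 2) = 0 :=
        hg.eq_zero_of_forall_add_eq_zero fun x => by
          rw [hgc, hgc, CharTwo.add_self_eq_zero]
      exact one_ne_zero (congrFun hone ⟨0, by omega⟩)
    rw [hb, Prod.mk_zero_zero]
  · intro hab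
    obtain ⟨rfl, rfl⟩ := Prod.mk.inj hab
    exact ⟨0, fun x y => by rw [add_zero, add_zero, CharTwo.add_self_eq_zero]⟩
end

section
/- Let n be even, n ≥ 2, and let g, h : 𝔽₂ⁿ → 𝔽₂ both be bent with deg(g) = deg(h) = 2, related by g = h∘φ + 1 for some affinity φ of 𝔽₂ⁿ. Define f : 𝔽₂^(n+1) → 𝔽₂ by f(x, y) = y·g(x) + (1+y)·h(x), and assume deg(f) = 3. Then the linear space of f is trivial: V(f) = {0}. -/
/-- Adding a linear term to the pull-back of a quadratic function along an additive map
gives a function of degree at most two. -/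
theorem degLE_two_comp_add {α β : Type*} [AddCommGroup α] [AddCommGroup β] {h : β → ZMod 2}
    (hh : degLE 2 h) (L : α →+ β) (m : α →+ ZMod 2) : degLE 2 fun z => h (L z) + m z := by
  intro l hl
  obtain ⟨a, b, c, rfl⟩ := List.length_eq_three.mp hl
  funext z
  have key := congrFun (hh [L a, L b, L c] rfl) (L z)
  have two : (2 : ZMod 2) = 0 := rfl
  simp only [List.foldr, Dop, map_add] at key ⊢
  linear_combination key + (4 * m z + 2 * m a + 2 * m b + 2 * m c) * two

/-- A bent function on at least two variables has no nonzero constant derivative. -/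
theorem IsBent.eq_zero_of_Dop_const {n : ℕ} (hn : 2 ≤ n) {h : (Fin n → ZMod 2) → ZMod 2}
    (hh : IsBent h) {a : Fin n → ZMod 2} {c : ZMod 2} (hc : ∀ x, Dop a h x = c) : a = 0 := by
  by_contra ha
  have hw := hh a ha
  have hpos : 0 < 2 ^ (n - 1) := by positivity
  have hlt : 2 ^ (n - 1) < 2 ^ n := Nat.pow_lt_pow_right one_lt_two (by omega)
  simp only [wt, hc] at hw
  by_cases h1 : c = 1
  · simp [h1] at hw
    omega
  · simp [h1] at hw
    omega

theorem stmt_8 (n : ℕ) (hne : Even n) (hn : 2 ≤ n)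
    (g h : (Fin n → ZMod 2) → ZMod 2)
    (hg : IsBent g) (hh : IsBent h)
    (hg2 : degLE 2 g ∧ ¬ degLE 1 g) (hh2 : degLE 2 h ∧ ¬ degLE 1 h)
    (M : (Fin n → ZMod 2) ≃ₗ[ZMod 2] (Fin n → ZMod 2)) (w : Fin n → ZMod 2)
    (hrel : ∀ x, g x = h (M x + w) + 1)
    (f : ((Fin n → ZMod 2) × ZMod 2) → ZMod 2)
    (hf : ∀ (x : Fin n → ZMod 2) (y : ZMod 2), f (x, y) = y * g x + (1 + y) * h x)
    (hf3 : degLE 3 f ∧ ¬ degLE 2 f) :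
    {a : (Fin n → ZMod 2) × ZMod 2 | ∃ c : ZMod 2, ∀ z, f (z + a) + f z = c} = {0} := by
  have two : (2 : ZMod 2) = 0 := rfl
  have zero_or_one : ∀ y : ZMod 2, y = 0 ∨ y = 1 := by decide
  refine Set.Subset.antisymm ?_ ?_
  · rintro ⟨b, e⟩ ⟨c, hc⟩
    rcases zero_or_one e with rfl | rfl
    · have hb : b = 0 := hh.eq_zero_of_Dop_const hn (c := c) fun x => by
        simpa [hf, Dop] using hc (x, 0)
      simp [hb]
    · have hgx : ∀ x, g x = h (x + b) + c := fun x => by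
        have hx := hc (x, 1)
        simp only [Prod.mk_add_mk, hf] at hx
        linear_combination hx - (g (x + b) + 2 * h (x + b) + h x) * two
      let L : ((Fin n → ZMod 2) × ZMod 2) →+ (Fin n → ZMod 2) :=
        (AddMonoidHom.id _).coprod (LinearMap.toSpanSingleton (ZMod 2) _ b).toAddMonoidHom
      let m : ((Fin n → ZMod 2) × ZMod 2) →+ ZMod 2 :=
        (AddMonoidHom.mulRight c).comp (AddMonoidHom.snd _ _)
      have hfL : f = fun z => h (L z) + m z := by
        funext ⟨x, y⟩
        rcases zero_or_one y with rfl | rfl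
        · simp [hf, L, m]
        · simp [hf, L, m, hgx, CharTwo.add_self_eq_zero]
      exact absurd (hfL ▸ degLE_two_comp_add hh2.1 L m) hf3.2
  · rintro _ rfl
    exact ⟨0, fun z => by simp [CharTwo.add_self_eq_zero]⟩
end

section
/- Let n be even, n ≥ 2, and let g, h : 𝔽₂ⁿ → 𝔽₂ both be bent. Define f : 𝔽₂^(n+1) → 𝔽₂ by f(x, y) = y·g(x) + (1+y)·h(x). If deg(f) = max(deg(g), deg(h)) + 1, then the linear space of f is trivial: V(f) = {0}. -/
/-- The algebraic degree of a Boolean function: the least `d` such that all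
`(d+1)`-fold iterated derivatives vanish. -/
noncomputable def adeg {α : Type*} [Add α] (f : α → ZMod 2) : ℕ :=
  sInf {d | degLE d f}

section Derivatives

variable {α β : Type*}

theorem Dop_zero [Add α] (a : α) : Dop a (fun _ => (0 : ZMod 2)) = fun _ => 0 := by
  funext x
  simp [Dop]

theorem foldr_Dop_comp [Add α] [Add β] (L : α → β) (hL : ∀ x y, L (x + y) = L x + L y)
    (f : β → ZMod 2) (l : List α) :
    l.foldr Dop (fun x => f (L x)) = fun x => (l.map L).foldr Dop f (L x) := by
  induction l with
  | nil => rfl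
  | cons a l ih =>
    funext x
    simp [ih, Dop, hL]

theorem degLE.comp [Add α] [Add β] {L : α → β} (hL : ∀ x y, L (x + y) = L x + L y)
    {d : ℕ} {f : β → ZMod 2} (hf : degLE d f) : degLE d (fun x => f (L x)) := by
  intro l hl
  rw [foldr_Dop_comp L hL, hf _ (by simpa using hl)]

theorem foldr_Dop_add [Add α] (u v : α → ZMod 2) (l : List α) :
    l.foldr Dop (fun x => u x + v x) = fun x => l.foldr Dop u x + l.foldr Dop v x := by
  induction l with
  | nil => rfl
  | cons a l ih =>
    funext x
    simp only [List.foldr_cons, ih, Dop]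
    ring

theorem degLE.add [Add α] {d : ℕ} {u v : α → ZMod 2} (hu : degLE d u) (hv : degLE d v) :
    degLE d (fun x => u x + v x) := by
  intro l hl
  rw [foldr_Dop_add, hu l hl, hv l hl]
  simp

theorem degLE.mono [Add α] {d e : ℕ} {f : α → ZMod 2} (hf : degLE d f) (hde : d ≤ e) :
    degLE e f := by
  induction e, hde using Nat.le_induction with
  | base => exact hf
  | succ e _ ih =>
    rintro (_ | ⟨a, l⟩) hl
    · simp at hl
    · rw [List.foldr_cons, ih l (by simpa using hl), Dop_zero]

theorem degLE_one_of_additive [Add α] (f : α → ZMod 2) (hf : ∀ x y, f (x + y) = f x + f y) :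
    degLE 1 f := by
  intro l hl
  obtain ⟨a, b, rfl⟩ := List.length_eq_two.mp hl
  funext x
  simp only [List.foldr_cons, List.foldr_nil, Dop, hf]
  linear_combination (2 * f x + f a + f b) * (CharTwo.two_eq_zero : (2 : ZMod 2) = 0)

theorem degLE.adeg_le [Add α] {d : ℕ} {f : α → ZMod 2} (hf : degLE d f) : adeg f ≤ d :=
  Nat.sInf_le hf

theorem degLE.degLE_adeg [Add α] {d : ℕ} {f : α → ZMod 2} (hf : degLE d f) :
    degLE (adeg f) f :=
  Nat.sInf_mem (s := {d | degLE d f}) ⟨d, hf⟩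

theorem degLE_adeg_of_pos [Add α] {f : α → ZMod 2} (hf : 0 < adeg f) : degLE (adeg f) f :=
  Nat.sInf_mem (Nat.nonempty_of_pos_sInf hf)

end Derivatives

theorem IsBent.Dop_ne_const {n : ℕ} (hn : n ≠ 0) {f : (Fin n → ZMod 2) → ZMod 2}
    (hf : IsBent f) {a : Fin n → ZMod 2} (ha : a ≠ 0) (c : ZMod 2) :
    Dop a f ≠ fun _ => c := by
  intro h
  have hw := hf a ha
  have hpos : 0 < 2 ^ (n - 1) := by positivity
  have hlt : 2 ^ (n - 1) < 2 ^ n := Nat.pow_lt_pow_right (by norm_num) (by omega)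
  rw [h] at hw
  by_cases hc : c = 1
  · simp [wt, hc] at hw
    omega
  · simp [wt, hc] at hw
    omega

theorem IsBent.not_degLE_zero {n : ℕ} (hn : n ≠ 0) {f : (Fin n → ZMod 2) → ZMod 2}
    (hf : IsBent f) : ¬ degLE 0 f := by
  intro h
  have : NeZero n := ⟨hn⟩
  exact hf.Dop_ne_const hn (one_ne_zero : (1 : Fin n → ZMod 2) ≠ 0) 0 (h [1] rfl)

theorem stmt_9 (n : ℕ) (hne : Even n) (hn : 2 ≤ n)
    (g h : (Fin n → ZMod 2) → ZMod 2)
    (hg : IsBent g) (hh : IsBent h)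
    (f : ((Fin n → ZMod 2) × ZMod 2) → ZMod 2)
    (hf : ∀ (x : Fin n → ZMod 2) (y : ZMod 2), f (x, y) = y * g x + (1 + y) * h x)
    (hdeg : adeg f = max (adeg g) (adeg h) + 1) :
    {a : (Fin n → ZMod 2) × ZMod 2 | ∃ c : ZMod 2, ∀ z, f (z + a) + f z = c} = {0} := by
  have hn0 : n ≠ 0 := by omega
  have hZ : ∀ y : ZMod 2, y = 0 ∨ y = 1 := by decide
  have hfh : ∀ x, f (x, 0) = h x := fun x => by simp [hf]
  have hfg : ∀ x, f (x, 1) = g x := fun x => by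
    rw [hf, CharTwo.add_self_eq_zero]
    simp
  ext ⟨α, β⟩
  rw [Set.mem_singleton_iff]
  constructor
  · rintro ⟨c, hc⟩
    rcases hZ β with rfl | rfl
    · by_contra hα
      refine hh.Dop_ne_const hn0 (a := α) (fun h0 => hα (by rw [h0]; rfl)) c ?_
      funext x
      simpa [hfh, Dop] using hc (x, 0)
    · exfalso
      have hfL : f = fun z => h (z.1 + z.2 • α) + c * z.2 := by
        funext ⟨x, y⟩
        rcases hZ y with rfl | rfl
        · simp [hfh]
        · have hx := hc (x, 1)
          rw [Prod.mk_add_mk, CharTwo.add_self_eq_zero, hfh, hfg] at hx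
          simp only [hfg, one_smul, mul_one]
          rw [← hx, ← add_assoc, CharTwo.add_self_eq_zero, zero_add]
      have hhf : h = fun x => f (x, 0) := funext fun x => (hfh x).symm
      have hdf : degLE (adeg f) f := degLE_adeg_of_pos (by omega)
      have hdh : degLE (adeg h) h := by
        refine degLE.degLE_adeg (d := adeg f) ?_
        rw [hhf]
        exact hdf.comp (L := fun x => (x, (0 : ZMod 2))) (by simp)
      have hpos : 1 ≤ adeg h := by
        by_contra h0
        exact hh.not_degLE_zero hn0 (hdh.mono (by omega))
      have hle : degLE (adeg h) f := by
        rw [hfL]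
        refine degLE.add ?_ ?_
        · refine hdh.comp (L := fun z : (Fin n → ZMod 2) × ZMod 2 => z.1 + z.2 • α) ?_
          intro x y
          simp only [Prod.fst_add, Prod.snd_add, add_smul]
          abel
        · refine (degLE_one_of_additive _ fun x y => ?_).mono hpos
          rw [Prod.snd_add, mul_add]
      have := hle.adeg_le
      omega
  · intro h0
    exact ⟨0, fun z => by rw [h0, add_zero, CharTwo.add_self_eq_zero]⟩
end

section
/- Let n ≥ 1 and f : 𝔽₂ⁿ → 𝔽₂ be a Boolean function. Then there exists a nonzero a ∈ 𝔽₂ⁿ such that D_a f is constant (i.e., dim V(f) ≥ 1) if and only if f has splitting index 1, i.e., there exist an affinity φ of 𝔽₂ⁿ, a constant c ∈ 𝔽₂, and a Boolean function h : 𝔽₂^(n−1) → 𝔽₂ such that (f∘φ)(x₁,…,x_n) = c·x₁ + h(x₂,…,x_n) for all x ∈ 𝔽₂ⁿ. -/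
/-- Any nonzero vector of a vector space is carried to any other nonzero vector by some
linear automorphism. -/
theorem exists_linearEquiv_apply_eq_of_ne_zero {K V : Type*} [Field K] [AddCommGroup V] [Module K V]
    {v w : V} (hv : v ≠ 0) (hw : w ≠ 0) :
    ∃ M : V ≃ₗ[K] V, M v = w := by
  obtain ⟨M, hM⟩ := Submodule.exists_linearEquiv_restrict_eq
    ((LinearEquiv.toSpanNonzeroSingleton K V v hv).symm ≪≫ₗ
      LinearEquiv.toSpanNonzeroSingleton K V w hw)
  refine ⟨M, (hM ⟨v, Submodule.mem_span_singleton_self v⟩).symm.trans ?_⟩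
  rw [← LinearEquiv.toSpanNonzeroSingleton_one K V v hv, LinearEquiv.trans_apply,
    LinearEquiv.symm_apply_apply, LinearEquiv.toSpanNonzeroSingleton_one]

theorem stmt_10 (n : ℕ) (hn : 1 ≤ n) (f : (Fin n → ZMod 2) → ZMod 2) :
    (∃ a : Fin n → ZMod 2, a ≠ 0 ∧ ∃ c : ZMod 2, ∀ x, f (x + a) + f x = c) ↔
    (∃ (M : (Fin n → ZMod 2) ≃ₗ[ZMod 2] (Fin n → ZMod 2)) (w : Fin n → ZMod 2)
       (c : ZMod 2) (h : (Fin (n - 1) → ZMod 2) → ZMod 2),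
       ∀ x : Fin n → ZMod 2,
         f (M x + w) = c * x ⟨0, by omega⟩ +
           h (fun i => x ⟨i.val + 1, by have := i.isLt; omega⟩)) := by
  obtain ⟨m, rfl⟩ : ∃ m, n = m + 1 := ⟨n - 1, by omega⟩
  have he : (Pi.single 0 1 : Fin (m + 1) → ZMod 2) ≠ 0 := by simp
  constructor
  · rintro ⟨a, ha, c, hc⟩
    obtain ⟨M, hM⟩ := exists_linearEquiv_apply_eq_of_ne_zero (K := ZMod 2) he ha
    refine ⟨M, 0, c, fun y => f (M (Fin.cons 0 y : Fin (m + 1) → ZMod 2)), fun x => ?_⟩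
    change f (M x + 0) = c * x 0 + f (M (Fin.cons 0 (Fin.tail x) : Fin (m + 1) → ZMod 2))
    rw [add_zero]
    obtain h0 | h1 : x 0 = 0 ∨ x 0 = 1 := by generalize x 0 = t; decide +revert
    · rw [h0, mul_zero, zero_add, ← h0, Fin.cons_self_tail]
    · have hx : x = (Fin.cons 0 (Fin.tail x) : Fin (m + 1) → ZMod 2) + Pi.single 0 1 := by
        ext i
        refine Fin.cases ?_ (fun j => ?_) i <;> simp [h1, Fin.tail]
      have hMx : M x = M (Fin.cons 0 (Fin.tail x) : Fin (m + 1) → ZMod 2) + a := by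
        rw [← hM, ← map_add, ← hx]
      rw [hMx, h1, mul_one, ← hc (M (Fin.cons 0 (Fin.tail x) : Fin (m + 1) → ZMod 2)), add_assoc,
        CharTwo.add_self_eq_zero, add_zero]
  · rintro ⟨M, w, c, h, hf⟩
    refine ⟨M (Pi.single 0 1), by simp, c, fun x => ?_⟩
    obtain ⟨y, rfl⟩ : ∃ y, M y + w = x := ⟨M.symm (x - w), by simp⟩
    rw [add_right_comm, ← map_add, hf, hf]
    have htail : (fun i : Fin (m + 1 - 1) => (y + Pi.single 0 1 : Fin (m + 1) → ZMod 2)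
        ⟨i.val + 1, by have := i.isLt; omega⟩) =
        fun i => y ⟨i.val + 1, by have := i.isLt; omega⟩ := by
      funext i
      simp [Fin.ext_iff]
    rw [htail, add_add_add_comm, CharTwo.add_self_eq_zero, add_zero, ← mul_add]
    change c * (y 0 + (Pi.single 0 1 : Fin (m + 1) → ZMod 2) 0 + y 0) = c
    rw [add_right_comm, CharTwo.add_self_eq_zero, zero_add, Pi.single_eq_same, mul_one]
end

section
/- Let n be even, n ≥ 2, and let f : 𝔽₂ⁿ → 𝔽₂ be a Boolean function which admits a nonzero linear structure (i.e., there exists a ≠ 0 with D_a f constant). Then |Γ(f)| ≤ 2ⁿ − 4, where Γ(f) = {a ∈ 𝔽₂ⁿ : D_a f is balanced}. -/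
/-- `Γ(f)`: the set of points where the derivative of `f` is balanced. -/
def Gam {n : ℕ} (f : (Fin n → ZMod 2) → ZMod 2) : Set (Fin n → ZMod 2) :=
  {a | wt (Dop a f) = 2 ^ (n - 1)}

/-- The nontrivial additive character of `ZMod 2` with integer values. -/
def signChar (z : ZMod 2) : ℤ := if z = 0 then 1 else -1

theorem signChar_add (z w : ZMod 2) : signChar (z + w) = signChar z * signChar w := by
  revert z w; decide

theorem signChar_eq_one_sub (z : ZMod 2) : signChar z = 1 - 2 * (if z = 1 then 1 else 0) := by
  revert z; decide

theorem signChar_mul_self (z : ZMod 2) : signChar z * signChar z = 1 := by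
  revert z; decide

/-- The autocorrelation of a Boolean function at `b`. -/
def autocorrelation {n : ℕ} (f : (Fin n → ZMod 2) → ZMod 2) (b : Fin n → ZMod 2) : ℤ :=
  ∑ x, signChar (f (x + b) + f x)

theorem autocorrelation_eq_sub_wt {n : ℕ} (f : (Fin n → ZMod 2) → ZMod 2) (b : Fin n → ZMod 2) :
    autocorrelation f b = 2 ^ n - 2 * (wt (Dop b f) : ℤ) := by
  simp only [autocorrelation, signChar_eq_one_sub, Finset.sum_sub_distrib, ← Finset.mul_sum, wt,
    Dop]
  simp
  congr

theorem mem_Gam_iff_autocorrelation {n : ℕ} (hn : n ≠ 0) (f : (Fin n → ZMod 2) → ZMod 2)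
    (b : Fin n → ZMod 2) : b ∈ Gam f ↔ autocorrelation f b = 0 := by
  obtain ⟨m, rfl⟩ := Nat.exists_eq_succ_of_ne_zero hn
  rw [autocorrelation_eq_sub_wt]
  simp only [Gam, Set.mem_ofPred_eq, Nat.succ_eq_add_one, Nat.add_sub_cancel]
  zify
  rw [pow_succ]
  constructor <;> intro h <;> linarith

theorem autocorrelation_zero {n : ℕ} (f : (Fin n → ZMod 2) → ZMod 2) :
    autocorrelation f 0 = 2 ^ n := by
  simp [autocorrelation, CharTwo.add_self_eq_zero, signChar]

theorem autocorrelation_add {n : ℕ} {f : (Fin n → ZMod 2) → ZMod 2} {a : Fin n → ZMod 2}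
    {c : ZMod 2} (ha : ∀ x, f (x + a) + f x = c) (b : Fin n → ZMod 2) :
    autocorrelation f (b + a) = signChar c * autocorrelation f b := by
  rw [autocorrelation, autocorrelation, Finset.mul_sum]
  refine Finset.sum_congr rfl fun x _ => ?_
  rw [← signChar_add, ← ha (x + b), ← add_assoc]
  congr 1
  linear_combination -CharTwo.add_self_eq_zero (f (x + b))

/-- The square of a Walsh coefficient is the Fourier transform of the autocorrelation. -/
theorem sq_sum_signChar_add {n : ℕ} (f : (Fin n → ZMod 2) → ZMod 2)
    (l : (Fin n → ZMod 2) →+ ZMod 2) :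
    (∑ x, signChar (f x + l x)) ^ 2 = ∑ b, signChar (l b) * autocorrelation f b := by
  simp only [autocorrelation, Finset.mul_sum]
  rw [Finset.sum_comm, sq, Finset.sum_mul_sum]
  refine Finset.sum_congr rfl fun x _ => ?_
  rw [← Equiv.sum_comp (Equiv.addLeft x)]
  refine Finset.sum_congr rfl fun b _ => ?_
  rw [← signChar_add, ← signChar_add]
  congr 1
  simp only [Equiv.coe_addLeft, map_add]
  linear_combination CharTwo.add_self_eq_zero (l x)

theorem sq_ne_two_pow_of_odd {k : ℕ} (hk : Odd k) (w : ℤ) : w ^ 2 ≠ 2 ^ k := by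
  intro h
  have h2 : w.natAbs ^ 2 = 2 ^ k := by
    rw [← Int.natAbs_pow, h, Int.natAbs_pow]; rfl
  have h3 := congrArg (fun m => m.factorization 2) h2
  simp only [Nat.factorization_pow, Finsupp.smul_apply, Nat.prime_two.factorization_self,
    smul_eq_mul] at h3
  obtain ⟨j, rfl⟩ := hk
  omega

/-- In an even number of variables, the autocorrelation of a function with a nonzero linear
structure `a` does not vanish identically off `{0, a}`. -/
theorem exists_autocorrelation_ne_zero {n : ℕ} (hne : Even n) {f : (Fin n → ZMod 2) → ZMod 2}
    {a : Fin n → ZMod 2} (ha0 : a ≠ 0) {c : ZMod 2} (ha : ∀ x, f (x + a) + f x = c) :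
    ∃ b, b ≠ 0 ∧ b ≠ a ∧ autocorrelation f b ≠ 0 := by
  by_contra! hcon
  obtain ⟨i, hi⟩ := Function.ne_iff.mp ha0
  have hi1 : a i = 1 := by
    have h : ∀ z : ZMod 2, z ≠ 0 → z = 1 := by decide
    exact h _ hi
  let l : (Fin n → ZMod 2) →+ ZMod 2 :=
    (AddMonoidHom.mulLeft c).comp (Pi.evalAddMonoidHom (fun _ => ZMod 2) i)
  have hla : l a = c := by simp [l, hi1]
  have hRa : autocorrelation f a = signChar c * 2 ^ n := by
    simpa [autocorrelation_zero] using autocorrelation_add ha 0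
  have key := sq_sum_signChar_add f l
  rw [Finset.sum_eq_add_of_mem (f := fun b => signChar (l b) * autocorrelation f b) 0 a
    (Finset.mem_univ _) (Finset.mem_univ _) ha0.symm
    (fun b _ hb => by rw [hcon b hb.1 hb.2, mul_zero]), hla, hRa, autocorrelation_zero,
    ← mul_assoc, signChar_mul_self, map_zero] at key
  refine sq_ne_two_pow_of_odd hne.add_one _ (key.trans ?_)
  rw [show signChar 0 = 1 from rfl]
  ring

theorem stmt_11 (n : ℕ) (hne : Even n) (hn : 2 ≤ n)
    (f : (Fin n → ZMod 2) → ZMod 2)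
    (hls : ∃ a : Fin n → ZMod 2, a ≠ 0 ∧ ∃ c : ZMod 2, ∀ x, f (x + a) + f x = c) :
    (Gam f).ncard ≤ 2 ^ n - 4 := by
  obtain ⟨a, ha0, c, ha⟩ := hls
  obtain ⟨b, hb0, hba, hb⟩ := exists_autocorrelation_ne_zero hne ha0 ha
  have hc : signChar c ≠ 0 := left_ne_zero_of_mul_eq_one (signChar_mul_self c)
  have htrans : ∀ d, autocorrelation f d ≠ 0 → autocorrelation f (d + a) ≠ 0 := fun d hd => by
    rw [autocorrelation_add ha]
    exact mul_ne_zero hc hd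
  have h0 : autocorrelation f 0 ≠ 0 := by
    rw [autocorrelation_zero]
    positivity
  have hRa : autocorrelation f a ≠ 0 := by simpa using htrans 0 h0
  have hba0 : b + a ≠ 0 := fun h =>
    hba (funext fun j => CharTwo.add_eq_zero.mp (congrFun h j))
  have hsub : (({0, a, b, b + a} : Finset (Fin n → ZMod 2)) : Set (Fin n → ZMod 2)) ⊆
      (Gam f)ᶜ := by
    intro d hd
    rw [Set.mem_compl_iff, mem_Gam_iff_autocorrelation (by omega)]
    simp only [Finset.coe_insert, Finset.coe_singleton, Set.mem_insert_iff,
      Set.mem_singleton_iff] at hd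
    rcases hd with rfl | rfl | rfl | rfl
    exacts [h0, hRa, hb, htrans b hb]
  have hcard : ({0, a, b, b + a} : Finset (Fin n → ZMod 2)).card = 4 := by
    rw [Finset.card_insert_of_notMem, Finset.card_insert_of_notMem, Finset.card_pair]
    · simpa using ha0
    · simp [hba.symm, hb0]
    · simp [ha0.symm, hb0.symm, hba0.symm]
  have hle := Set.ncard_le_ncard hsub (Set.toFinite _)
  rw [Set.ncard_coe_finset, hcard] at hle
  have htot := Set.ncard_add_ncard_compl (Gam f)
  rw [Nat.card_eq_fintype_card, Fintype.card_fun, ZMod.card, Fintype.card_fin] at htot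
  omega
end

section
/- Let n be even, n ≥ 2, and let F : 𝔽₂ⁿ → 𝔽₂ⁿ be an APN function that is also a permutation (bijection) of 𝔽₂ⁿ. Then for every nonzero λ ∈ 𝔽₂ⁿ, the linear space of the component F_λ satisfies |V(F_λ)| ≤ 2 (i.e., dim V(F_λ) ≤ 1). -/
/-- The component `F_λ` of a vectorial Boolean function: `x ↦ λ · F(x)` (dot product mod 2). -/
def comp {n : ℕ} (lam : Fin n → ZMod 2) (F : (Fin n → ZMod 2) → (Fin n → ZMod 2)) :
    (Fin n → ZMod 2) → ZMod 2 :=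
  fun x => ∑ i, lam i * F x i

/-- `F` is APN: for every nonzero `a` and every `b`, `F(x+a) + F(x) = b` has at most
2 solutions. -/
def IsAPN {n : ℕ} (F : (Fin n → ZMod 2) → (Fin n → ZMod 2)) : Prop :=
  ∀ a : Fin n → ZMod 2, a ≠ 0 → ∀ b : Fin n → ZMod 2,
    (Finset.univ.filter fun x => F (x + a) + F x = b).card ≤ 2

/-- Two vectors over the field of two elements whose sum is zero are equal. -/
lemma eq_of_add_eq_zero_zmod_two {ι : Type*} {u v : ι → ZMod 2} (h : u + v = 0) : u = v :=
  funext fun i => CharTwo.add_eq_zero.mp (congrFun h i)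

/-- A derivative of a component of `F` is the component of the derivative of `F`. -/
lemma comp_add_comp {n : ℕ} (lam : Fin n → ZMod 2)
    (F : (Fin n → ZMod 2) → (Fin n → ZMod 2)) (x a : Fin n → ZMod 2) :
    comp lam F (x + a) + comp lam F x = lam ⬝ᵥ (F (x + a) + F x) := by
  simp [comp, dotProduct, mul_add, Finset.sum_add_distrib]

/-- A set of vectors orthogonal to a nonzero vector fills at most half of the space. -/
lemma two_mul_card_le_of_dotProduct_eq_zero {n : ℕ} {lam : Fin n → ZMod 2} (hlam : lam ≠ 0)
    (T : Finset (Fin n → ZMod 2)) (hT : ∀ y ∈ T, lam ⬝ᵥ y = 0) :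
    2 * T.card ≤ Fintype.card (Fin n → ZMod 2) := by
  obtain ⟨i, hi⟩ := Function.ne_iff.mp hlam
  let v : Fin n → ZMod 2 := Pi.single i 1
  have hv : lam ⬝ᵥ v ≠ 0 := by simpa [v] using hi
  have hdisj : Disjoint T (T.map (addRightEmbedding v)) := by
    refine Finset.disjoint_left.mpr fun y hy hy' => hv ?_
    obtain ⟨z, hz, rfl⟩ := Finset.mem_map.mp hy'
    simpa [dotProduct_add, hT z hz] using hT _ hy
  have hcard := Finset.card_le_univ (T.disjUnion _ hdisj)
  rw [Finset.card_disjUnion, Finset.card_map] at hcard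
  omega

/-- No derivative of a component of an APN permutation in a nonzero direction vanishes
identically. -/
lemma IsAPN.exists_comp_add_comp_ne_zero {n : ℕ} {F : (Fin n → ZMod 2) → (Fin n → ZMod 2)}
    (hF : IsAPN F) (hinj : Function.Injective F) {lam : Fin n → ZMod 2} (hlam : lam ≠ 0)
    {a : Fin n → ZMod 2} (ha : a ≠ 0) :
    ∃ x, comp lam F (x + a) + comp lam F x ≠ 0 := by
  by_contra! h
  let S := Finset.univ.image fun x => F (x + a) + F x
  have hS : Fintype.card (Fin n → ZMod 2) ≤ 2 * S.card :=
    Finset.card_le_mul_card_image Finset.univ 2 fun b _ => hF a ha b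
  have h0 : (0 : Fin n → ZMod 2) ∉ S := by
    intro hmem
    obtain ⟨x, -, hx⟩ := Finset.mem_image.mp hmem
    exact ha (by simpa using hinj (eq_of_add_eq_zero_zmod_two hx))
  have hT := two_mul_card_le_of_dotProduct_eq_zero hlam (insert 0 S) (by
    intro y hy
    rcases Finset.mem_insert.mp hy with rfl | hy
    · simp
    · obtain ⟨x, -, rfl⟩ := Finset.mem_image.mp hy
      rw [← comp_add_comp, h x])
  rw [Finset.card_insert_of_notMem h0] at hT
  omega

theorem stmt_13 (n : ℕ) (hne : Even n) (hn : 2 ≤ n)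
    (F : (Fin n → ZMod 2) → (Fin n → ZMod 2)) (hF : IsAPN F)
    (hperm : Function.Bijective F) :
    ∀ lam : Fin n → ZMod 2, lam ≠ 0 →
      {a : Fin n → ZMod 2 | ∃ c : ZMod 2, ∀ x, comp lam F (x + a) + comp lam F x = c}.ncard
        ≤ 2 := by
  intro lam hlam
  have key : ∀ a : Fin n → ZMod 2, a ≠ 0 →
      (∃ c : ZMod 2, ∀ x, comp lam F (x + a) + comp lam F x = c) →
      ∀ x, comp lam F (x + a) + comp lam F x = 1 := by
    rintro a ha ⟨c, hc⟩ x
    obtain ⟨y, hy⟩ := hF.exists_comp_add_comp_ne_zero hperm.injective hlam ha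
    rw [hc] at hy ⊢
    exact Fin.eq_one_of_ne_zero c hy
  by_contra! hcard
  obtain ⟨a, ⟨ha, ha0⟩, b, ⟨hb, hb0⟩, hab⟩ := (Set.one_lt_ncard (Set.toFinite _)).mp
    (show 1 < ({a : Fin n → ZMod 2 | ∃ c : ZMod 2,
        ∀ x, comp lam F (x + a) + comp lam F x = c} \ {0}).ncard by
      have := Set.ncard_sdiff_singleton_of_mem
        (show (0 : Fin n → ZMod 2) ∈ {a : Fin n → ZMod 2 | ∃ c : ZMod 2,
          ∀ x, comp lam F (x + a) + comp lam F x = c} from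
          ⟨0, fun x => by rw [add_zero, CharTwo.add_self_eq_zero]⟩)
      omega)
  have hDa := key a ha0 ha
  have hDb := key b hb0 hb
  obtain ⟨x, hx⟩ := hF.exists_comp_add_comp_ne_zero hperm.injective hlam
    (fun h => hab (eq_of_add_eq_zero_zmod_two h) : a + b ≠ 0)
  have hxa := hDa x
  have hxb := hDb (x + a)
  rw [add_assoc] at hxb
  apply hx
  calc comp lam F (x + (a + b)) + comp lam F x
      = (comp lam F (x + (a + b)) + comp lam F (x + a))
        + (comp lam F (x + a) + comp lam F x) := by
        rw [add_assoc, ← add_assoc (comp lam F (x + a)), CharTwo.add_self_eq_zero, zero_add]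
    _ = 0 := by rw [hxa, hxb, CharTwo.add_self_eq_zero]
end

section
/- Let Q : 𝔽₂ⁿ → 𝔽₂ⁿ be pure quadratic, i.e., every component Q_λ (λ ≠ 0) has algebraic degree exactly 2. Then Σ_{λ≠0} (|V(Q_λ)| − 1) ≥ 2ⁿ − 1, where the sum runs over all nonzero λ ∈ 𝔽₂ⁿ. Moreover, equality holds if and only if Q is APN. -/
/-- The linear space of a Boolean function: the set of points where the
derivative is a constant function. -/
def Vsp {n : ℕ} (f : (Fin n → ZMod 2) → ZMod 2) : Set (Fin n → ZMod 2) :=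
  {a | ∃ c : ZMod 2, ∀ x, f (x + a) + f x = c}

/-- The polarization `x ↦ Q (x + a) + Q x + Q a + Q 0` of a map of degree at most two,
as a linear map. -/
def polarMap {n : ℕ} (Q : (Fin n → ZMod 2) → (Fin n → ZMod 2))
    (hQ : ∀ lam : Fin n → ZMod 2, lam ≠ 0 → degLE 2 (comp lam Q)) (a : Fin n → ZMod 2) :
    (Fin n → ZMod 2) →ₗ[ZMod 2] (Fin n → ZMod 2) :=
  AddMonoidHom.toZModLinearMap 2
    (AddMonoidHom.mk' (fun x => Q (x + a) + Q x + Q a + Q 0) (by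
      intro x y
      funext i
      have h := congrFun (hQ (Pi.single i 1) (by simp) [y, x, a] rfl) 0
      simp only [List.foldr, Dop, comp, zero_add, Pi.single_apply, ite_mul, one_mul, zero_mul,
        Finset.sum_ite_eq', Finset.mem_univ, if_true] at h
      rw [add_comm y x] at h
      simp only [Pi.add_apply]
      linear_combination h - (Q (x + a) i + Q x i + Q a i + Q 0 i + Q (y + a) i + Q y i) *
        (CharTwo.two_eq_zero : (2 : ZMod 2) = 0)))

lemma polarMap_apply {n : ℕ} (Q : (Fin n → ZMod 2) → (Fin n → ZMod 2))
    (hQ : ∀ lam : Fin n → ZMod 2, lam ≠ 0 → degLE 2 (comp lam Q)) (a x : Fin n → ZMod 2) :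
    polarMap Q hQ a x = Q (x + a) + Q x + Q a + Q 0 := rfl

lemma mem_Vsp_comp_iff {n : ℕ} (Q : (Fin n → ZMod 2) → (Fin n → ZMod 2))
    (hQ : ∀ lam : Fin n → ZMod 2, lam ≠ 0 → degLE 2 (comp lam Q)) (lam a : Fin n → ZMod 2) :
    a ∈ Vsp (comp lam Q) ↔ ∀ x, lam ⬝ᵥ polarMap Q hQ a x = 0 := by
  have hcomp : ∀ x, comp lam Q x = lam ⬝ᵥ Q x := fun _ => rfl
  simp only [Vsp, Set.mem_ofPred_eq, polarMap_apply, dotProduct_add, hcomp]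
  constructor
  · rintro ⟨c, hc⟩ x
    have h0 := hc 0
    rw [zero_add] at h0
    rw [hc x, add_assoc, h0, CharTwo.add_self_eq_zero]
  · intro h
    refine ⟨lam ⬝ᵥ Q a + lam ⬝ᵥ Q 0, fun x => ?_⟩
    have hx := h x
    rwa [add_assoc, CharTwo.add_eq_zero] at hx

/-- The annihilator of the range of an endomorphism has as many elements as its kernel. -/
lemma card_annihilator_range_eq_card_ker {K : Type*} [Field K] {n : ℕ}
    (f : (Fin n → K) →ₗ[K] (Fin n → K)) :
    Nat.card {lam : Fin n → K // ∀ x, lam ⬝ᵥ f x = 0} = Nat.card (LinearMap.ker f) := by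
  have hf : f = f.toMatrix'.mulVecLin := by
    rw [← Matrix.toLin'_apply', Matrix.toLin'_toMatrix']
  have hset : ∀ lam : Fin n → K,
      (∀ x, lam ⬝ᵥ f x = 0) ↔ lam ∈ LinearMap.ker f.toMatrix'.transpose.mulVecLin := by
    intro lam
    rw [LinearMap.mem_ker, Matrix.mulVecLin_apply, Matrix.mulVec_transpose,
      ← dotProduct_eq_zero_iff]
    refine forall_congr' fun x => ?_
    conv_lhs => rw [hf]
    rw [Matrix.mulVecLin_apply, Matrix.dotProduct_mulVec]
  have hrank : Module.finrank K (LinearMap.ker f.toMatrix'.transpose.mulVecLin) =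
      Module.finrank K (LinearMap.ker f) := by
    have h1 := LinearMap.finrank_range_add_finrank_ker f.toMatrix'.transpose.mulVecLin
    have h2 := LinearMap.finrank_range_add_finrank_ker f.toMatrix'.mulVecLin
    have h3 : f.toMatrix'.transpose.rank = f.toMatrix'.rank := Matrix.rank_transpose _
    unfold Matrix.rank at h3
    rw [← hf] at h2 h3
    omega
  rw [Nat.card_congr (Equiv.subtypeEquivRight hset)]
  exact Nat.card_congr (LinearEquiv.ofFinrankEq _ _ hrank).toEquiv

lemma card_filter_ne_and_mem_eq_ncard_sub_one {α : Type*} [Fintype α] [DecidableEq α]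
    (s : Set α) [DecidablePred (· ∈ s)] {z : α} (hz : z ∈ s) :
    ((Finset.univ.filter (· ≠ z)).filter (· ∈ s)).card = s.ncard - 1 := by
  rw [← Set.ncard_sdiff_singleton_of_mem hz, ← Set.ncard_coe_finset]
  congr 1
  ext x
  simp [and_comm]

open Classical in
/-- Double counting of the pairs `(lam, a)` of nonzero vectors with `a ∈ Vsp (comp lam Q)`. -/
lemma sum_ncard_Vsp_sub_one_eq {n : ℕ} (Q : (Fin n → ZMod 2) → (Fin n → ZMod 2))
    (hQ : ∀ lam : Fin n → ZMod 2, lam ≠ 0 → degLE 2 (comp lam Q)) :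
    ∑ lam ∈ Finset.univ.filter (fun lam : Fin n → ZMod 2 => lam ≠ 0),
        ((Vsp (comp lam Q)).ncard - 1) =
      ∑ a ∈ Finset.univ.filter (fun a : Fin n → ZMod 2 => a ≠ 0),
        (Nat.card (LinearMap.ker (polarMap Q hQ a)) - 1) := by
  have key := Finset.sum_card_bipartiteAbove_eq_sum_card_bipartiteBelow
    (s := Finset.univ.filter (fun lam : Fin n → ZMod 2 => lam ≠ 0))
    (t := Finset.univ.filter (fun a : Fin n → ZMod 2 => a ≠ 0))
    (fun lam a => a ∈ Vsp (comp lam Q))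
  convert key using 2 with lam _ a _
  · rw [Finset.bipartiteAbove]
    convert (card_filter_ne_and_mem_eq_ncard_sub_one (Vsp (comp lam Q)) (z := 0) ?_).symm
    exact ⟨0, fun x => by rw [add_zero, CharTwo.add_self_eq_zero]⟩
  · rw [Finset.bipartiteBelow, ← card_annihilator_range_eq_card_ker]
    simp only [mem_Vsp_comp_iff Q hQ]
    convert (card_filter_ne_and_mem_eq_ncard_sub_one
      {lam | ∀ x, lam ⬝ᵥ polarMap Q hQ a x = 0} (z := 0) fun x => zero_dotProduct _).symm
    · exact Nat.card_coe_set_eq _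
    · exact Iff.rfl

lemma two_le_card_ker_polarMap {n : ℕ} (Q : (Fin n → ZMod 2) → (Fin n → ZMod 2))
    (hQ : ∀ lam : Fin n → ZMod 2, lam ≠ 0 → degLE 2 (comp lam Q)) {a : Fin n → ZMod 2}
    (ha : a ≠ 0) : 2 ≤ Nat.card (LinearMap.ker (polarMap Q hQ a)) := by
  have hmem : a ∈ LinearMap.ker (polarMap Q hQ a) := by
    rw [LinearMap.mem_ker, polarMap_apply, ZModModule.add_self, add_comm (Q 0), add_assoc,
      ZModModule.add_self]
  have : Nontrivial (LinearMap.ker (polarMap Q hQ a)) :=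
    ⟨⟨⟨a, hmem⟩, 0, fun h => ha (congrArg Subtype.val h)⟩⟩
  exact Finite.one_lt_card

lemma isAPN_iff_card_ker_polarMap {n : ℕ} (Q : (Fin n → ZMod 2) → (Fin n → ZMod 2))
    (hQ : ∀ lam : Fin n → ZMod 2, lam ≠ 0 → degLE 2 (comp lam Q)) :
    IsAPN Q ↔ ∀ a : Fin n → ZMod 2, a ≠ 0 →
      Nat.card (LinearMap.ker (polarMap Q hQ a)) ≤ 2 := by
  classical
  refine forall₂_congr fun a _ => ?_
  constructor
  · intro h
    convert h (Q a + Q 0)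
    rw [Nat.card_eq_fintype_card, Fintype.card_subtype]
    congr 1
    ext x
    simp only [Finset.mem_filter, Finset.mem_univ, true_and, LinearMap.mem_ker, polarMap_apply]
    rw [add_assoc, add_eq_zero_iff_eq_neg, ZModModule.neg_eq_self]
  · intro h b
    rw [Nat.card_eq_fintype_card, Fintype.card_subtype] at h
    rcases Finset.eq_empty_or_nonempty
      (Finset.univ.filter fun x => Q (x + a) + Q x = b) with he | ⟨y, hy⟩
    · simp [he]
    · refine le_trans (Finset.card_le_card_of_injOn (· + y) ?_ (add_left_injective y).injOn) h
      intro x hx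
      simp only [Finset.coe_filter, Finset.mem_filter, Finset.mem_univ, true_and,
        Set.mem_ofPred_eq, LinearMap.mem_ker] at hx hy ⊢
      rw [map_add, polarMap_apply, polarMap_apply, hx, hy, ZModModule.add_self]

theorem stmt_14 (n : ℕ)
    (Q : (Fin n → ZMod 2) → (Fin n → ZMod 2))
    (hquad : ∀ lam : Fin n → ZMod 2, lam ≠ 0 →
      degLE 2 (comp lam Q) ∧ ¬ degLE 1 (comp lam Q)) :
    2 ^ n - 1 ≤ ∑ lam ∈ Finset.univ.filter (fun lam : Fin n → ZMod 2 => lam ≠ 0),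
        ((Vsp (comp lam Q)).ncard - 1) ∧
    ((∑ lam ∈ Finset.univ.filter (fun lam : Fin n → ZMod 2 => lam ≠ 0),
        ((Vsp (comp lam Q)).ncard - 1)) = 2 ^ n - 1 ↔ IsAPN Q) := by
  have hQ := fun lam hlam => (hquad lam hlam).1
  have hcard : 2 ^ n - 1 =
      ∑ _a ∈ Finset.univ.filter (fun a : Fin n → ZMod 2 => a ≠ 0), 1 := by
    rw [← Finset.card_eq_sum_ones, Finset.filter_ne', Finset.card_erase_of_mem (Finset.mem_univ _)]
    simp
  have hle : ∀ a ∈ Finset.univ.filter (fun a : Fin n → ZMod 2 => a ≠ 0),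
      1 ≤ Nat.card (LinearMap.ker (polarMap Q hQ a)) - 1 := fun a ha =>
    Nat.le_sub_one_of_lt (two_le_card_ker_polarMap Q hQ (Finset.mem_filter.mp ha).2)
  rw [sum_ncard_Vsp_sub_one_eq Q hQ, hcard]
  refine ⟨Finset.sum_le_sum hle, ?_⟩
  rw [eq_comm, Finset.sum_eq_sum_iff_of_le hle, isAPN_iff_card_ker_polarMap Q hQ]
  simp only [Finset.mem_filter, Finset.mem_univ, true_and]
  refine forall₂_congr fun a ha => ?_
  have := two_le_card_ker_polarMap Q hQ ha
  omega
end

section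
/- Let n be even, n ≥ 2, let k ≥ 1 be an integer, and let F : 𝔽_{2ⁿ} → 𝔽_{2ⁿ} be the power function F(x) = x^(2^k+1). For α ∈ 𝔽_{2ⁿ}, let F_α be the Boolean function F_α(x) = Tr(α·x^(2^k+1)) on 𝔽_{2ⁿ}, where Tr is the absolute trace to 𝔽₂. Then: (i) for nonzero α, F_α is bent if and only if α does not lie in the image of F; (ii) the number of α ∈ 𝔽_{2ⁿ} for which F_α is bent equals (e−1)(2ⁿ−1)/e, where e = gcd(2ⁿ−1, 2^k+1). -/
/-- The Hamming weight of a Boolean function on a finite domain. -/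
def wtF {F : Type*} [Fintype F] (f : F → ZMod 2) [DecidablePred fun x => f x = 1] : ℕ :=
  (Finset.univ.filter fun x => f x = 1).card

/-- A Boolean function that is complemented by some translation is balanced. -/
theorem two_mul_wtF_of_add_right {F : Type*} [AddGroup F] [Fintype F] (f : F → ZMod 2)
    [DecidablePred fun x => f x = 1] (u : F) (hu : ∀ x, f (x + u) = f x + 1) :
    2 * wtF f = Fintype.card F := by
  have h1 : ∀ z : ZMod 2, z + 1 = 1 ↔ ¬ z = 1 := by decide
  have h : (Finset.univ.filter fun x => f x = 1).card =
      (Finset.univ.filter fun x => ¬ f x = 1).card := by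
    rw [← Finset.card_map (Equiv.addRight u).toEmbedding]
    congr 1
    ext y
    obtain ⟨x, rfl⟩ := (Equiv.addRight u).surjective y
    simp [hu, h1]
  have := Finset.card_filter_add_card_filter_not (s := (Finset.univ : Finset F)) (fun x => f x = 1)
  rw [Finset.card_univ] at this
  unfold wtF
  omega

/-- A constant Boolean function is not balanced. -/
theorem two_mul_wtF_const_ne {F : Type*} [Fintype F] [Nonempty F] (f : F → ZMod 2)
    [DecidablePred fun x => f x = 1] (d : ZMod 2) (hf : ∀ x, f x = d) :
    2 * wtF f ≠ Fintype.card F := by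
  have hpos : 0 < Fintype.card F := Fintype.card_pos
  by_cases hd : d = 1
  · have : wtF f = Fintype.card F := by simp [wtF, hf, hd]
    omega
  · have : wtF f = 0 := by simp [wtF, hf, hd]
    omega

section FiniteFieldCharTwo

variable {F : Type*} [Field F] [Fintype F] [Algebra (ZMod 2) F]

theorem trace_pow_two_pow (k : ℕ) (x : F) :
    Algebra.trace (ZMod 2) F (x ^ 2 ^ k) = Algebra.trace (ZMod 2) F x := by
  induction k with
  | zero => simp
  | succ k ih =>
    rw [← ih, pow_succ, pow_mul]
    have := Algebra.trace_eq_of_algEquiv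
      (FiniteField.frobeniusAlgEquivOfAlgebraic (ZMod 2) F) (x ^ 2 ^ k)
    simpa using this

theorem exists_pow_two_pow_eq (k : ℕ) (y : F) : ∃ x : F, x ^ 2 ^ k = y := by
  have : CharP F 2 := charP_of_injective_algebraMap' (ZMod 2) 2
  obtain ⟨x, hx⟩ := (bijective_iterateFrobenius F 2 k).2 y
  exact ⟨x, by simpa [iterateFrobenius_def] using hx⟩

/-- The derivative of `x ↦ Tr (α * x ^ (2 ^ k + 1))` is affine. -/
theorem trace_gold_derivative (k : ℕ) (α a x : F) :
    Algebra.trace (ZMod 2) F (α * (x + a) ^ (2 ^ k + 1)) +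
        Algebra.trace (ZMod 2) F (α * x ^ (2 ^ k + 1)) =
      Algebra.trace (ZMod 2) F ((α * a + (α * a ^ 2 ^ k) ^ 2 ^ k) * x ^ 2 ^ k) +
        Algebra.trace (ZMod 2) F (α * a ^ (2 ^ k + 1)) := by
  have : CharP F 2 := charP_of_injective_algebraMap' (ZMod 2) 2
  rw [add_mul, map_add, ← mul_pow, trace_pow_two_pow, ← map_add, ← map_add, ← map_add,
    pow_succ (x + a), add_pow_char_pow]
  congr 1
  linear_combination (α * x ^ 2 ^ k * x) * CharTwo.two_eq_zero (R := F)

/-- The derivative of `x ↦ Tr (α * x ^ (2 ^ k + 1))` at `a` is balanced iff its linear part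
does not vanish. -/
theorem two_mul_wtF_gold_derivative_iff [DecidableEq F] (k : ℕ) (α a : F) :
    2 * wtF (fun x => Algebra.trace (ZMod 2) F (α * (x + a) ^ (2 ^ k + 1)) +
        Algebra.trace (ZMod 2) F (α * x ^ (2 ^ k + 1))) = Fintype.card F ↔
      α * a + (α * a ^ 2 ^ k) ^ 2 ^ k ≠ 0 := by
  have : CharP F 2 := charP_of_injective_algebraMap' (ZMod 2) 2
  constructor
  · intro h h0
    refine two_mul_wtF_const_ne _ (Algebra.trace (ZMod 2) F (α * a ^ (2 ^ k + 1)))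
      (fun x => ?_) h
    rw [trace_gold_derivative, h0, zero_mul, map_zero, zero_add]
  · intro h
    obtain ⟨b, hb⟩ : ∃ b, Algebra.trace (ZMod 2) F
        ((α * a + (α * a ^ 2 ^ k) ^ 2 ^ k) * b) ≠ 0 := by
      by_contra! hf
      exact h ((traceForm_nondegenerate (ZMod 2) F).1 _ hf)
    obtain ⟨u, rfl⟩ := exists_pow_two_pow_eq k b
    refine two_mul_wtF_of_add_right _ u fun x => ?_
    have h1 : ∀ z : ZMod 2, z ≠ 0 → z = 1 := by decide
    rw [trace_gold_derivative, trace_gold_derivative, add_pow_char_pow, mul_add, map_add,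
      h1 _ hb]
    ring

theorem exists_gold_kernel_iff (k : ℕ) {α : F} (hα : α ≠ 0) :
    (∃ a : F, a ≠ 0 ∧ α * a + (α * a ^ 2 ^ k) ^ 2 ^ k = 0) ↔
      α ∈ Set.range fun x : F => x ^ (2 ^ k + 1) := by
  have : CharP F 2 := charP_of_injective_algebraMap' (ZMod 2) 2
  constructor
  · rintro ⟨a, ha, h⟩
    have hβ : (α * a ^ (2 ^ k + 1)) ^ 2 ^ k = α * a ^ (2 ^ k + 1) := by
      have h' := CharTwo.add_eq_zero.1 h
      rw [pow_succ, ← mul_assoc, mul_pow, ← h']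
      ring
    obtain ⟨s, hs⟩ := exists_pow_two_pow_eq 1 (α * a ^ (2 ^ k + 1))
    rw [pow_one] at hs
    have hs' : s ^ 2 ^ k = s := by
      apply frobenius_inj F 2
      simp only [frobenius_def]
      rw [pow_right_comm, hs, hβ]
    refine ⟨s / a, ?_⟩
    change (s / a) ^ (2 ^ k + 1) = α
    rw [div_pow, pow_succ s, hs', ← sq, hs]
    field_simp
  · rintro ⟨b, rfl⟩
    have hb : b ≠ 0 := by
      rintro rfl
      simp at hα
    refine ⟨b⁻¹, inv_ne_zero hb, ?_⟩
    have h : b ^ (2 ^ k + 1) * b⁻¹ ^ 2 ^ k = b := by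
      rw [pow_succ', mul_assoc, ← mul_pow, mul_inv_cancel₀ hb, one_pow, mul_one]
    have h' : b ^ (2 ^ k + 1) * b⁻¹ = b ^ 2 ^ k := by
      rw [pow_succ, mul_assoc, mul_inv_cancel₀ hb, mul_one]
    change b ^ (2 ^ k + 1) * b⁻¹ + (b ^ (2 ^ k + 1) * b⁻¹ ^ 2 ^ k) ^ 2 ^ k = 0
    rw [h, h', CharTwo.add_self_eq_zero]

end FiniteFieldCharTwo

theorem FiniteField.ncard_range_pow {F : Type*} [Field F] [Fintype F] {m : ℕ} (hm : m ≠ 0) :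
    (Set.range fun x : F => x ^ m).ncard =
      (Fintype.card F - 1) / (Fintype.card F - 1).gcd m + 1 := by
  have hset : (Set.range fun x : F => x ^ m) =
      insert 0 (Units.val '' ((powMonoidHom m : Fˣ →* Fˣ).range : Set Fˣ)) := by
    ext y
    constructor
    · rintro ⟨x, rfl⟩
      rcases eq_or_ne x 0 with rfl | hx
      · simp [hm]
      · exact Or.inr ⟨Units.mk0 x hx ^ m, ⟨Units.mk0 x hx, rfl⟩, by simp⟩
    · rintro (rfl | ⟨_, ⟨u, rfl⟩, rfl⟩)
      · exact ⟨0, by simp [hm]⟩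
      · exact ⟨u, by simp⟩
  have hF : Nat.card Fˣ = Fintype.card F - 1 := by rw [Nat.card_units, Nat.card_eq_fintype_card]
  rw [hset, Set.ncard_insert_of_notMem (by rintro ⟨u, -, hu⟩; exact u.ne_zero hu) (Set.toFinite _),
    Set.ncard_image_of_injective _ Units.val_injective, ← hF, ← IsCyclic.card_powMonoidHom_range]
  rfl

theorem stmt_18 (n : ℕ) (hne : Even n) (hn : 2 ≤ n) (k : ℕ) (hk : 1 ≤ k)
    (F : Type*) [Field F] [Fintype F] [DecidableEq F] [Algebra (ZMod 2) F]
    (hcard : Fintype.card F = 2 ^ n) :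
    (∀ α : F, α ≠ 0 →
      ((∀ a : F, a ≠ 0 →
          wtF (fun x => Algebra.trace (ZMod 2) F (α * (x + a) ^ (2 ^ k + 1)) +
                Algebra.trace (ZMod 2) F (α * x ^ (2 ^ k + 1))) = 2 ^ (n - 1)) ↔
        α ∉ Set.range fun x : F => x ^ (2 ^ k + 1))) ∧
    {α : F | ∀ a : F, a ≠ 0 →
        wtF (fun x => Algebra.trace (ZMod 2) F (α * (x + a) ^ (2 ^ k + 1)) +
              Algebra.trace (ZMod 2) F (α * x ^ (2 ^ k + 1))) = 2 ^ (n - 1)}.ncard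
      = (Nat.gcd (2 ^ n - 1) (2 ^ k + 1) - 1) * (2 ^ n - 1) /
          Nat.gcd (2 ^ n - 1) (2 ^ k + 1) := by
  have hbal : ∀ w : ℕ, w = 2 ^ (n - 1) ↔ 2 * w = Fintype.card F := fun w => by
    rw [hcard, ← Nat.sub_add_cancel (show 1 ≤ n by omega), pow_succ', Nat.add_sub_cancel]
    omega
  have hbent : ∀ α : F, α ≠ 0 →
      ((∀ a : F, a ≠ 0 →
          wtF (fun x => Algebra.trace (ZMod 2) F (α * (x + a) ^ (2 ^ k + 1)) +
                Algebra.trace (ZMod 2) F (α * x ^ (2 ^ k + 1))) = 2 ^ (n - 1)) ↔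
        α ∉ Set.range fun x : F => x ^ (2 ^ k + 1)) := fun α hα => by
    rw [← exists_gold_kernel_iff k hα]
    simp only [hbal, two_mul_wtF_gold_derivative_iff]
    push Not
    rfl
  refine ⟨hbent, ?_⟩
  have hset : {α : F | ∀ a : F, a ≠ 0 →
        wtF (fun x => Algebra.trace (ZMod 2) F (α * (x + a) ^ (2 ^ k + 1)) +
              Algebra.trace (ZMod 2) F (α * x ^ (2 ^ k + 1))) = 2 ^ (n - 1)} =
      (Set.range fun x : F => x ^ (2 ^ k + 1))ᶜ := by
    ext α
    rcases eq_or_ne α 0 with rfl | hα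
    · refine iff_of_false (fun h => ?_) (fun h => h ⟨0, by simp⟩)
      have := (two_mul_wtF_gold_derivative_iff k 0 1).1 ((hbal _).1 (h 1 one_ne_zero))
      simp at this
    · exact hbent α hα
  rw [hset, Set.ncard_compl, FiniteField.ncard_range_pow (Nat.succ_ne_zero _),
    Nat.card_eq_fintype_card, hcard]
  obtain ⟨t, ht⟩ := Nat.gcd_dvd_left (2 ^ n - 1) (2 ^ k + 1)
  have hpos : 0 < Nat.gcd (2 ^ n - 1) (2 ^ k + 1) := Nat.gcd_pos_of_pos_right _ (Nat.succ_pos _)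
  set e := Nat.gcd (2 ^ n - 1) (2 ^ k + 1)
  rw [add_comm, ← Nat.sub_sub, ht, Nat.mul_div_cancel_left _ hpos, mul_left_comm,
    Nat.mul_div_cancel_left _ hpos, Nat.sub_mul, one_mul]
end

section
/- Let n be even, n ≥ 2, let k ≥ 1 be an integer, and let F : 𝔽_{2ⁿ} → 𝔽_{2ⁿ} be the power function F(x) = x^(2^k+1). Then F is APN if and only if gcd(2ⁿ−1, 2^k+1) = 3 and gcd(n, 2k) = 2. -/
/-- In even dimension, the arithmetic condition on `k` amounts to `n` and `k` being coprime. -/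
lemma gcd_conditions_iff_coprime {n k : ℕ} (hne : Even n) :
    (Nat.gcd (2 ^ n - 1) (2 ^ k + 1) = 3 ∧ Nat.gcd n (2 * k) = 2) ↔ Nat.Coprime n k := by
  obtain ⟨m, rfl⟩ := hne
  rw [← two_mul, Nat.gcd_mul_left]
  have three_dvd_iff : 3 ∣ 2 ^ k + 1 ↔ Odd k := by
    rcases Nat.even_or_odd' k with ⟨j, rfl | rfl⟩
    · have h : 2 ^ (2 * j) % 3 = 1 := by rw [pow_mul, Nat.pow_mod]; simp
      have h' : ¬ Odd (2 * j) := by simp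
      simp only [h', iff_false]
      omega
    · have h : 2 ^ (2 * j) % 3 = 1 := by rw [pow_mul, Nat.pow_mod]; simp
      have h' : Odd (2 * j + 1) := odd_two_mul_add_one j
      simp only [h', iff_true, pow_succ]
      omega
  rw [Nat.coprime_mul_iff_left, Nat.coprime_two_left, ← three_dvd_iff]
  constructor
  · rintro ⟨h3, hmk⟩
    exact ⟨h3 ▸ Nat.gcd_dvd_right _ _, show Nat.gcd m k = 1 by omega⟩
  · rintro ⟨h3, hmk⟩
    refine ⟨Nat.dvd_antisymm ?_ (Nat.dvd_gcd ?_ h3), by rw [hmk.gcd_eq_one, mul_one]⟩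
    · have h : 2 ^ k + 1 ∣ 2 ^ (2 * k) - 1 := by
        refine ⟨2 ^ k - 1, ?_⟩
        rw [mul_comm 2 k, pow_mul]
        simpa using Nat.sq_sub_sq (2 ^ k) 1
      have hg := Nat.gcd_dvd_gcd_of_dvd_right (2 ^ (2 * m) - 1) h
      rwa [Nat.pow_sub_one_gcd_pow_sub_one, Nat.gcd_mul_left, hmk.gcd_eq_one] at hg
    · rw [pow_mul]
      have h := Nat.sub_dvd_pow_sub_pow (2 ^ 2) 1 m
      rwa [one_pow] at h

/-- The Gold derivative is affine over the field with two elements. -/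
lemma gold_derivative {F : Type*} [Field F] [CharP F 2] (k : ℕ) (x a : F) :
    (x + a) ^ (2 ^ k + 1) + x ^ (2 ^ k + 1) =
      x ^ 2 ^ k * a + a ^ 2 ^ k * x + a ^ (2 ^ k + 1) := by
  rw [pow_succ, add_pow_char_pow]
  linear_combination x ^ (2 ^ k + 1) * CharTwo.two_eq_zero (R := F)

/-- Coprime powers of Frobenius have only the prime field as common fixed points. -/
lemma eq_zero_or_one_of_frobenius_fixed {F : Type*} [Field F] [Fintype F] {n k : ℕ}
    (hcard : Fintype.card F = 2 ^ n) (h : Nat.Coprime n k) {z : F} (hz : z ^ 2 ^ k = z) :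
    z = 0 ∨ z = 1 := by
  refine or_iff_not_imp_left.2 fun hz0 => ?_
  have hk : z ^ (2 ^ k - 1) = 1 := by
    apply mul_right_cancel₀ hz0
    rw [← pow_succ, Nat.sub_add_cancel Nat.one_le_two_pow, hz, one_mul]
  have hn : z ^ (2 ^ n - 1) = 1 := hcard ▸ FiniteField.pow_card_sub_one_eq_one z hz0
  have hg := Nat.dvd_gcd (orderOf_dvd_of_pow_eq_one hn) (orderOf_dvd_of_pow_eq_one hk)
  rw [Nat.pow_sub_one_gcd_pow_sub_one, h.gcd_eq_one] at hg
  simpa using hg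

/-- If `n` and `k` share a factor, the `k`-th power of Frobenius has a fixed point outside the
prime field. -/
lemma exists_frobenius_fixed_ne {F : Type*} [Field F] [Fintype F] {n k : ℕ} (hn : n ≠ 0)
    (hcard : Fintype.card F = 2 ^ n) (h : ¬ Nat.Coprime n k) :
    ∃ z : F, z ^ 2 ^ k = z ∧ z ≠ 0 ∧ z ≠ 1 := by
  classical
  set d := Nat.gcd n k with hd
  have hd2 : 2 ≤ d := by
    have : d ≠ 0 := fun h0 => hn (Nat.eq_zero_of_gcd_eq_zero_left h0)
    have : d ≠ 1 := h
    omega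
  have hpow : 2 ^ 2 ≤ 2 ^ d := Nat.pow_le_pow_right two_pos hd2
  have hcardU : Nat.card Fˣ = 2 ^ n - 1 := by
    rw [Nat.card_eq_fintype_card, Fintype.card_units, hcard]
  obtain ⟨u, hu⟩ := IsCyclic.exists_ofOrder_eq_natCard (α := Fˣ)
  have hdvd : 2 ^ d - 1 ∣ orderOf u := by
    rw [hu, hcardU, hd, ← Nat.pow_sub_one_gcd_pow_sub_one]
    exact Nat.gcd_dvd_left _ _
  have hw := orderOf_pow_orderOf_div (orderOf_pos u).ne' hdvd
  set w := u ^ (orderOf u / (2 ^ d - 1))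
  have hwk : w ^ (2 ^ k - 1) = 1 := by
    rw [← orderOf_dvd_iff_pow_eq_one, hw, hd, ← Nat.pow_sub_one_gcd_pow_sub_one]
    exact Nat.gcd_dvd_right _ _
  refine ⟨w, ?_, w.ne_zero, fun h1 => ?_⟩
  · rw [← Units.val_pow_eq_pow_val, ← Nat.sub_add_cancel (Nat.one_le_two_pow (n := k)), pow_succ,
      hwk, one_mul]
  · rw [Units.val_eq_one.1 h1, orderOf_one] at hw
    omega

theorem stmt_19 (n : ℕ) (hne : Even n) (hn : 2 ≤ n) (k : ℕ) (hk : 1 ≤ k)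
    (F : Type*) [Field F] [Fintype F] (hcard : Fintype.card F = 2 ^ n) :
    ((∀ a : F, a ≠ 0 → ∀ b : F,
        {x : F | (x + a) ^ (2 ^ k + 1) + x ^ (2 ^ k + 1) = b}.ncard ≤ 2) ↔
      (Nat.gcd (2 ^ n - 1) (2 ^ k + 1) = 3 ∧ Nat.gcd n (2 * k) = 2)) := by
  have htwo : (2 : F) = 0 := by
    have h := Nat.cast_card_eq_zero F
    rw [hcard] at h
    push_cast at h
    exact eq_zero_of_pow_eq_zero h
  have : CharP F 2 := CharTwo.of_one_ne_zero_of_two_eq_zero one_ne_zero htwo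
  rw [gcd_conditions_iff_coprime hne]
  simp only [gold_derivative]
  constructor
  · intro hapn
    by_contra hcop
    obtain ⟨z, hz, hz0, hz1⟩ := exists_frobenius_fixed_ne (by omega) hcard hcop
    refine absurd (hapn 1 one_ne_zero 1) (not_le.2 ?_)
    rw [Set.two_lt_ncard (Set.toFinite _)]
    refine ⟨0, ?_, 1, ?_, z, ?_, zero_ne_one, hz0.symm, hz1.symm⟩
    · simp
    · simp [CharTwo.add_self_eq_zero]
    · simp [hz, CharTwo.add_self_eq_zero]
  · intro hcop a ha b
    rcases Set.eq_empty_or_nonempty {x : F | x ^ 2 ^ k * a + a ^ 2 ^ k * x + a ^ (2 ^ k + 1) = b}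
      with he | ⟨y, hy⟩
    · simp [he]
    refine (Set.ncard_le_ncard (t := {y, y + a}) ?_ (Set.toFinite _)).trans
      ((Set.ncard_insert_le _ _).trans (by rw [Set.ncard_singleton]))
    intro x hx
    have hfix : ((x - y) / a) ^ 2 ^ k = (x - y) / a := by
      rw [div_pow, sub_pow_char_pow, div_eq_div_iff (pow_ne_zero _ ha) ha]
      rw [Set.mem_ofPred_eq] at hx hy
      linear_combination hx - hy - (x - y) * a ^ 2 ^ k * htwo
    rcases eq_zero_or_one_of_frobenius_fixed hcard hcop hfix with h | h
    · left
      simpa [ha, sub_eq_zero] using h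
    · right
      rw [div_eq_one_iff_eq ha] at h
      rw [Set.mem_singleton_iff, ← h]
      ring
end
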